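/- arXiv:1409.0439 — 5 statements merged into one kernel-verified Lean document; each statement's English description precedes it below -/
import Mathlib

section
/- Let c : ℝ → ℝ be a C^∞ (infinitely differentiable) function satisfying c(s·t) = c(s)·c(t) for all s, t ∈ ℝ. Then either c is identically zero, or there exists a natural number n such that c(t) = tⁿ for all t ∈ ℝ. (This is the fact underlying h-completeness: a smooth action of the multiplicative monoid (ℝ, ·) on a graded bundle admits only non-negative integer weights.) -/
/-- A multiplicative real function with a nonzero `n`-th derivative at the origin is `t ↦ tⁿ`. -/
theorem eq_pow_of_iteratedDeriv_zero_ne_zero {c : ℝ → ℝ} {n : ℕ} (hc : ContDiff ℝ n c)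
    (hmul : ∀ s t : ℝ, c (s * t) = c s * c t) (hn : iteratedDeriv n c 0 ≠ 0) (s : ℝ) :
    c s = s ^ n := by
  have h₁ : iteratedDeriv n (fun t ↦ c (s * t)) 0 = s ^ n * iteratedDeriv n c 0 := by
    simp [iteratedDeriv_comp_const_mul hc s]
  have h₂ : iteratedDeriv n (fun t ↦ c (s * t)) 0 = c s * iteratedDeriv n c 0 := by
    simp_rw [hmul s]
    exact iteratedDeriv_const_mul_field (c s) c
  exact mul_right_cancel₀ hn (h₂.symm.trans h₁)

/-- A smooth function all of whose derivatives vanish at the origin is bounded on `[0, 1]` by a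
multiple of any given power. -/
theorem exists_abs_le_mul_pow_of_iteratedDeriv_zero {c : ℝ → ℝ}
    (hc : ContDiff ℝ (⊤ : ℕ∞) c) (h : ∀ n, iteratedDeriv n c 0 = 0) (n : ℕ) :
    ∃ C : ℝ, ∀ x ∈ Set.Icc (0 : ℝ) 1, |c x| ≤ C * x ^ (n + 1) := by
  obtain ⟨C, hC⟩ := exists_taylor_mean_remainder_bound (n := n) (zero_le_one' ℝ)
    (hc.of_le (by exact_mod_cast le_top)).contDiffOn
  refine ⟨C, fun x hx ↦ ?_⟩
  have hT : taylorWithinEval c n (Set.Icc 0 1) 0 x = 0 := by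
    rw [taylor_within_apply]
    refine Finset.sum_eq_zero fun k _ ↦ ?_
    rw [iteratedDerivWithin_eq_iteratedDeriv (uniqueDiffOn_Icc zero_lt_one)
      (hc.of_le (by exact_mod_cast le_top)).contDiffAt (by simp), h k, smul_zero]
  simpa [hT] using hC x hx

/-- A nonzero smooth multiplicative real function has a nonzero derivative of some order
at the origin. -/
theorem exists_iteratedDeriv_zero_ne_zero {c : ℝ → ℝ}
    (hc : ContDiff ℝ (⊤ : ℕ∞) c) (hmul : ∀ s t : ℝ, c (s * t) = c s * c t) (h1 : c 1 = 1) :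
    ∃ n, iteratedDeriv n c 0 ≠ 0 := by
  by_contra! h
  have hpow : ∀ k : ℕ, c ((1 / 2) ^ k) = c (1 / 2) ^ k := by
    intro k
    induction k with
    | zero => simpa using h1
    | succ k ih => rw [pow_succ, hmul, ih, pow_succ]
  have hpos : 0 < |c (1 / 2)| := by
    refine abs_pos.mpr fun h0 ↦ ?_
    have := hmul (1 / 2) 2
    rw [h0, zero_mul, one_div_mul_cancel two_ne_zero, h1] at this
    exact one_ne_zero this
  obtain ⟨n, hn⟩ := exists_pow_lt_of_lt_one hpos (by norm_num : (1 / 2 : ℝ) < 1)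
  obtain ⟨C, hC⟩ := exists_abs_le_mul_pow_of_iteratedDeriv_zero hc h n
  have hn' : (1 / 2 : ℝ) ^ (n + 1) < |c (1 / 2)| :=
    (pow_le_pow_of_le_one (by norm_num) (by norm_num) n.le_succ).trans_lt hn
  have hp : (0 : ℝ) < (1 / 2) ^ (n + 1) := by positivity
  obtain ⟨k, hk⟩ := pow_unbounded_of_one_lt C ((one_lt_div hp).mpr hn')
  have hb := hC ((1 / 2) ^ k) ⟨by positivity, pow_le_one₀ (by norm_num) (by norm_num)⟩
  rw [hpow, abs_pow, pow_right_comm] at hb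
  rw [div_pow, lt_div_iff₀ (pow_pos hp k)] at hk
  exact absurd hb hk.not_ge

/-- A smooth multiplicative self-map of `(ℝ, ·)` is either identically zero or
a monomial `t ↦ tⁿ` for some natural number `n`. -/
theorem smooth_multiplicative_real_eq_zero_or_pow (c : ℝ → ℝ)
    (hc : ContDiff ℝ (⊤ : ℕ∞) c) (hmul : ∀ s t : ℝ, c (s * t) = c s * c t) :
    (∀ t : ℝ, c t = 0) ∨ ∃ n : ℕ, ∀ t : ℝ, c t = t ^ n := by
  by_cases h1 : c 1 = 0
  · exact Or.inl fun t ↦ by simpa [h1] using hmul t 1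
  · have h1' : c 1 = 1 := by
      have := hmul 1 1
      rw [one_mul] at this
      exact (mul_eq_left₀ h1).mp this.symm
    obtain ⟨n, hn⟩ := exists_iteratedDeriv_zero_ne_zero hc hmul h1'
    exact Or.inr ⟨n, eq_pow_of_iteratedDeriv_zero_ne_zero
      (hc.of_le (by exact_mod_cast le_top)) hmul hn⟩
end

section
/- Fix weights w : Fin n → ℕ with w i ≥ 1 for every i, and a degree k ∈ ℕ. Let f : (Fin m → ℝ) × (Fin n → ℝ) → ℝ be a C^∞ function such that for all t ∈ ℝ, all x ∈ (Fin m → ℝ) and all y ∈ (Fin n → ℝ), one has f(x, h_t y) = t^k · f(x, y). Then there exists a finitely supported family of C^∞ functions c_α : (Fin m → ℝ) → ℝ, indexed by multi-indices α : Fin n → ℕ satisfying Σᵢ (w i)·(α i) = k, such that f(x, y) = Σ_α c_α(x) · Πᵢ (y i)^(α i) for all x, y. (Homogeneous functions on a graded bundle are polynomial in the homogeneous fibre coordinates with smooth coefficients in the weight-zero base coordinates.) -/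
open scoped BigOperators

/-- The dilation `(x, y) ↦ (x, h_t y)` as a continuous linear map. -/
noncomputable def weightedDilation (m : ℕ) {n : ℕ} (w : Fin n → ℕ) (t : ℝ) :
    ((Fin m → ℝ) × (Fin n → ℝ)) →L[ℝ] ((Fin m → ℝ) × (Fin n → ℝ)) :=
  (ContinuousLinearMap.id ℝ (Fin m → ℝ)).prodMap
    (ContinuousLinearMap.pi fun i => t ^ w i • ContinuousLinearMap.proj i)

theorem weightedDilation_apply (m : ℕ) {n : ℕ} (w : Fin n → ℕ) (t : ℝ)
    (x : Fin m → ℝ) (y : Fin n → ℝ) :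
    weightedDilation m w t (x, y) = (x, fun i => t ^ w i * y i) := by
  rfl

theorem continuous_weightedDilation (m : ℕ) {n : ℕ} (w : Fin n → ℕ)
    (x : Fin m → ℝ) (y : Fin n → ℝ) :
    Continuous fun t => weightedDilation m w t (x, y) := by
  simp only [weightedDilation_apply]
  fun_prop

/-- The derivative of `f` in the direction of the `i`-th fibre coordinate. -/
noncomputable def fibreDeriv {m n : ℕ} (f : (Fin m → ℝ) × (Fin n → ℝ) → ℝ) (i : Fin n)
    (p : (Fin m → ℝ) × (Fin n → ℝ)) : ℝ :=
  fderiv ℝ f p (0, Pi.single i 1)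

theorem contDiff_fibreDeriv {m n : ℕ} {f : (Fin m → ℝ) × (Fin n → ℝ) → ℝ}
    (hf : ContDiff ℝ (⊤ : ℕ∞) f) (i : Fin n) : ContDiff ℝ (⊤ : ℕ∞) (fibreDeriv f i) :=
  (hf.fderiv_right (m := (⊤ : ℕ∞)) (by simp)).clm_apply contDiff_const

theorem pow_mul_fibreDeriv_weightedDilation {m n k : ℕ} {w : Fin n → ℕ}
    {f : (Fin m → ℝ) × (Fin n → ℝ) → ℝ} (hf : Differentiable ℝ f)
    (hom : ∀ t p, f (weightedDilation m w t p) = t ^ k * f p) (i : Fin n) (t : ℝ)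
    (p : (Fin m → ℝ) × (Fin n → ℝ)) :
    t ^ w i * fibreDeriv f i (weightedDilation m w t p) = t ^ k * fibreDeriv f i p := by
  have h₁ : HasFDerivAt (fun q => f (weightedDilation m w t q))
      ((fderiv ℝ f (weightedDilation m w t p)).comp (weightedDilation m w t)) p :=
    (hf _).hasFDerivAt.comp p (weightedDilation m w t).hasFDerivAt
  have h₂ : HasFDerivAt (fun q => f (weightedDilation m w t q)) (t ^ k • fderiv ℝ f p) p := by
    simp only [hom]
    exact (hf p).hasFDerivAt.const_mul _
  have h := congrArg (fun L => L (0, Pi.single i 1)) (h₁.unique h₂)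
  have hv : weightedDilation m w t (0, Pi.single i 1)
      = t ^ w i • ((0, Pi.single i 1) : (Fin m → ℝ) × (Fin n → ℝ)) := by
    rw [weightedDilation_apply]
    ext j
    · simp
    · by_cases hj : j = i
      · subst hj; simp
      · simp [hj]
  simpa only [ContinuousLinearMap.comp_apply, hv, map_smul, smul_eq_mul,
    smul_apply, fibreDeriv] using h

theorem fibreDeriv_weightedDilation {m n k : ℕ} {w : Fin n → ℕ}
    {f : (Fin m → ℝ) × (Fin n → ℝ) → ℝ} (hf : ContDiff ℝ (⊤ : ℕ∞) f)
    (hom : ∀ t p, f (weightedDilation m w t p) = t ^ k * f p) {i : Fin n} (hi : w i ≤ k) (t : ℝ)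
    (p : (Fin m → ℝ) × (Fin n → ℝ)) :
    fibreDeriv f i (weightedDilation m w t p) = t ^ (k - w i) * fibreDeriv f i p := by
  have hc : Continuous fun t => fibreDeriv f i (weightedDilation m w t p) :=
    (contDiff_fibreDeriv hf i).continuous.comp (continuous_weightedDilation m w p.1 p.2)
  refine congrFun (Continuous.ext_on (dense_compl_singleton (0 : ℝ)) hc
    (g := fun t => t ^ (k - w i) * fibreDeriv f i p) (by fun_prop) fun s hs => ?_) t
  have h := pow_mul_fibreDeriv_weightedDilation (hf.differentiable (by simp)) hom i s p
  rw [← Nat.add_sub_cancel' hi, pow_add, mul_assoc] at h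
  exact mul_left_cancel₀ (pow_ne_zero _ hs) h

theorem fibreDeriv_eq_zero {m n k : ℕ} {w : Fin n → ℕ}
    {f : (Fin m → ℝ) × (Fin n → ℝ) → ℝ} (hf : ContDiff ℝ (⊤ : ℕ∞) f)
    (hom : ∀ t p, f (weightedDilation m w t p) = t ^ k * f p) {i : Fin n} (hi : k < w i)
    (p : (Fin m → ℝ) × (Fin n → ℝ)) :
    fibreDeriv f i p = 0 := by
  have hc : Continuous fun t => fibreDeriv f i (weightedDilation m w t p) :=
    (contDiff_fibreDeriv hf i).continuous.comp (continuous_weightedDilation m w p.1 p.2)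
  have h := congrFun (Continuous.ext_on (dense_compl_singleton (0 : ℝ))
    (f := fun t => t ^ (w i - k) * fibreDeriv f i (weightedDilation m w t p))
    (g := fun _ => fibreDeriv f i p) (by fun_prop) (by fun_prop) fun s hs => ?_) 0
  · simpa [Nat.sub_ne_zero_of_lt hi] using h.symm
  · have h := pow_mul_fibreDeriv_weightedDilation (hf.differentiable (by simp)) hom i s p
    rw [← Nat.add_sub_cancel' hi.le, pow_add, mul_assoc] at h
    exact mul_left_cancel₀ (pow_ne_zero _ hs) h

/-- Euler's identity for weighted homogeneous functions. -/
theorem sum_weight_mul_fibreDeriv {m n k : ℕ} {w : Fin n → ℕ}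
    {f : (Fin m → ℝ) × (Fin n → ℝ) → ℝ} (hf : Differentiable ℝ f)
    (hom : ∀ t p, f (weightedDilation m w t p) = t ^ k * f p)
    (p : (Fin m → ℝ) × (Fin n → ℝ)) :
    ∑ i, w i * p.2 i * fibreDeriv f i p = k * f p := by
  obtain ⟨x, y⟩ := p
  have hy : HasDerivAt (fun t : ℝ => fun i => t ^ w i * y i) (fun i => w i * y i) 1 := by
    refine hasDerivAt_pi.2 fun i => ?_
    simpa using (hasDerivAt_pow (w i) (1 : ℝ)).mul_const (y i)
  have hd : HasDerivAt (fun t => weightedDilation m w t (x, y)) (0, fun i => w i * y i) 1 :=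
    (hasDerivAt_const 1 x).prodMk hy
  have h₁ := (hf (weightedDilation m w 1 (x, y))).hasFDerivAt.comp_hasDerivAt 1 hd
  have h₂ : HasDerivAt (f ∘ fun t => weightedDilation m w t (x, y)) (k * f (x, y)) 1 := by
    have he : (f ∘ fun t => weightedDilation m w t (x, y)) = fun t => t ^ k * f (x, y) :=
      funext fun t => hom t (x, y)
    rw [he]
    simpa using (hasDerivAt_pow k (1 : ℝ)).mul_const (f (x, y))
  rw [← h₁.unique h₂]
  have hp : weightedDilation m w 1 (x, y) = (x, y) := by simp [weightedDilation_apply]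
  have hv : ((0, fun i => w i * y i) : (Fin m → ℝ) × (Fin n → ℝ))
      = ∑ i, (w i * y i) • ((0, Pi.single i 1) : (Fin m → ℝ) × (Fin n → ℝ)) := by
    ext j
    · simp [Prod.fst_sum]
    · simp [Prod.snd_sum, Pi.single_apply]
  rw [hp, hv, map_sum]
  simp only [map_smul, smul_eq_mul, fibreDeriv]

/-- Functions polynomial in the fibre coordinates, homogeneous of weight `k`, with smooth
coefficients in the base coordinates. -/
def fibrePolynomials (m : ℕ) {n : ℕ} (w : Fin n → ℕ) (k : ℕ) :
    AddSubmonoid ((Fin m → ℝ) × (Fin n → ℝ) → ℝ) :=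
  AddSubmonoid.closure {g | ∃ (α : Fin n → ℕ) (a : (Fin m → ℝ) → ℝ),
    ∑ i, w i * α i = k ∧ ContDiff ℝ (⊤ : ℕ∞) a ∧ g = fun p => a p.1 * ∏ i, p.2 i ^ α i}

theorem mul_coord_mem_fibrePolynomials {m n k : ℕ} {w : Fin n → ℕ}
    {g : (Fin m → ℝ) × (Fin n → ℝ) → ℝ} (hg : g ∈ fibrePolynomials m w k) (r : ℝ) (i : Fin n) :
    (fun p => r * p.2 i * g p) ∈ fibrePolynomials m w (w i + k) := by
  induction hg using AddSubmonoid.closure_induction with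
  | mem g hg =>
    obtain ⟨α, a, hα, ha, rfl⟩ := hg
    refine AddSubmonoid.subset_closure
      ⟨Pi.single i 1 + α, fun x => r * a x, ?_, contDiff_const.mul ha, ?_⟩
    · simp [mul_add, Finset.sum_add_distrib, hα, Pi.single_apply]
    · funext p
      have : ∏ j, p.2 j ^ (Pi.single i 1 : Fin n → ℕ) j = p.2 i := by
        simp [Pi.single_apply, pow_ite, Finset.prod_ite_eq']
      simp only [Pi.add_apply, pow_add, Finset.prod_mul_distrib, this]
      ring
  | zero =>
    simp only [Pi.zero_apply, mul_zero]
    exact zero_mem (fibrePolynomials m w (w i + k))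
  | add g₁ g₂ _ _ h₁ h₂ =>
    convert add_mem h₁ h₂ using 1
    funext p
    simp [mul_add]

theorem exists_finsupp_of_mem_fibrePolynomials {m n k : ℕ} {w : Fin n → ℕ}
    {g : (Fin m → ℝ) × (Fin n → ℝ) → ℝ} (hg : g ∈ fibrePolynomials m w k) :
    ∃ c : (Fin n → ℕ) →₀ ((Fin m → ℝ) → ℝ),
      (∀ α ∈ c.support, ∑ i, w i * α i = k) ∧
      (∀ α, ContDiff ℝ (⊤ : ℕ∞) (c α)) ∧
      ∀ p, g p = c.sum fun α a => a p.1 * ∏ i, p.2 i ^ α i := by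
  classical
  induction hg using AddSubmonoid.closure_induction with
  | mem g hg =>
    obtain ⟨α, a, hα, ha, rfl⟩ := hg
    refine ⟨Finsupp.single α a, fun β hβ => ?_, fun β => ?_, fun p => ?_⟩
    · rwa [Finset.mem_singleton.1 (Finsupp.support_single_subset hβ)]
    · rw [Finsupp.single_apply]
      split_ifs
      · exact ha
      · exact contDiff_const
    · rw [Finsupp.sum_single_index (by simp)]
  | zero => exact ⟨0, by simp, fun _ => contDiff_const, by simp⟩
  | add g₁ g₂ _ _ h₁ h₂ =>
    obtain ⟨c₁, hs₁, hc₁, he₁⟩ := h₁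
    obtain ⟨c₂, hs₂, hc₂, he₂⟩ := h₂
    refine ⟨c₁ + c₂, fun α hα => ?_, fun α => (hc₁ α).add (hc₂ α), fun p => ?_⟩
    · exact (Finset.mem_union.1 (Finsupp.support_add hα)).elim (hs₁ α) (hs₂ α)
    · rw [Finsupp.sum_add_index' (by simp) (by simp [add_mul]), Pi.add_apply, he₁, he₂]

theorem mem_fibrePolynomials_of_homogeneous {m n : ℕ} {w : Fin n → ℕ} (hw : ∀ i, 1 ≤ w i)
    (k : ℕ) {f : (Fin m → ℝ) × (Fin n → ℝ) → ℝ} (hf : ContDiff ℝ (⊤ : ℕ∞) f)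
    (hom : ∀ t p, f (weightedDilation m w t p) = t ^ k * f p) :
    f ∈ fibrePolynomials m w k := by
  induction k using Nat.strong_induction_on generalizing f with
  | _ k ih =>
    rcases Nat.eq_zero_or_pos k with rfl | hk
    · refine AddSubmonoid.subset_closure ⟨0, fun x => f (x, 0), by simp,
        hf.comp (contDiff_id.prodMk contDiff_const), funext fun p => ?_⟩
      have h := hom 0 p
      have h₀ : weightedDilation m w 0 p = (p.1, 0) := by
        rw [← Prod.mk.eta (p := p), weightedDilation_apply]
        ext j
        · rfl
        · simp [Nat.one_le_iff_ne_zero.1 (hw j)]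
      simpa [h₀] using h.symm
    · have he : f = ∑ i, fun p => (w i / k : ℝ) * p.2 i * fibreDeriv f i p := by
        funext p
        have hk' : (k : ℝ) ≠ 0 := by positivity
        have h := sum_weight_mul_fibreDeriv (hf.differentiable (by simp)) hom p
        rw [Finset.sum_apply, eq_comm, ← mul_right_inj' hk', ← h, Finset.mul_sum]
        refine Finset.sum_congr rfl fun i _ => ?_
        field_simp
      rw [he]
      refine sum_mem fun i _ => ?_
      rcases le_or_gt (w i) k with hi | hi
      · have h := ih (k - w i) (Nat.sub_lt hk (hw i)) (contDiff_fibreDeriv hf i)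
          (fibreDeriv_weightedDilation hf hom hi)
        simpa [Nat.add_sub_cancel' hi] using mul_coord_mem_fibrePolynomials h (w i / k) i
      · simp only [fibreDeriv_eq_zero hf hom hi, mul_zero]
        exact zero_mem (fibrePolynomials m w k)

/-- Homogeneous functions of degree `k` on a trivial graded bundle
`ℝᵐ × ℝⁿ` (with base coordinates `x` of weight `0` and fibre coordinates `yᵢ`
of weight `w i ≥ 1`) are polynomial in the fibre coordinates with smooth
coefficients in the base coordinates. -/
theorem homogeneous_smooth_is_fibre_polynomial (m n : ℕ) (w : Fin n → ℕ)
    (hw : ∀ i, 1 ≤ w i) (k : ℕ)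
    (f : (Fin m → ℝ) × (Fin n → ℝ) → ℝ) (hf : ContDiff ℝ (⊤ : ℕ∞) f)
    (hom : ∀ (t : ℝ) (x : Fin m → ℝ) (y : Fin n → ℝ),
      f (x, fun i => t ^ (w i) * y i) = t ^ k * f (x, y)) :
    ∃ c : (Fin n → ℕ) →₀ ((Fin m → ℝ) → ℝ),
      (∀ α ∈ c.support, ∑ i, w i * α i = k) ∧
      (∀ α, ContDiff ℝ (⊤ : ℕ∞) (c α)) ∧
      (∀ (x : Fin m → ℝ) (y : Fin n → ℝ),
        f (x, y) = ∑ α ∈ c.support, c α x * ∏ i, y i ^ α i) := by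
  obtain ⟨c, hs, hc, he⟩ := exists_finsupp_of_mem_fibrePolynomials
    (mem_fibrePolynomials_of_homogeneous hw k hf fun t p => hom t p.1 p.2)
  exact ⟨c, hs, hc, fun x y => he (x, y)⟩
end

section
/- Fix weights w : Fin n → ℕ with w i ≥ 1 for every i, and a degree k ∈ ℕ. Let f : (Fin n → ℝ) → ℝ be a C^∞ function such that f(h_t y) = t^k · f(y) for all t ∈ ℝ and all y. Then there exists a multivariate polynomial P ∈ MvPolynomial (Fin n) ℝ which is weighted homogeneous of degree k with respect to the weights w (i.e. every monomial α in the support of P satisfies Σᵢ (w i)·(α i) = k) such that f(y) = P(y) for all y. (Homogeneous functions of degree k on a graded bundle over a point are weighted-homogeneous polynomials.) -/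
theorem fderiv_single_weighted_scaling {n : ℕ} {w : Fin n → ℕ} {k : ℕ}
    {f : (Fin n → ℝ) → ℝ} (hf : Differentiable ℝ f)
    (hom : ∀ (t : ℝ) (y : Fin n → ℝ), f (fun i => t ^ (w i) * y i) = t ^ k * f y)
    (i : Fin n) (t : ℝ) (y : Fin n → ℝ) :
    t ^ (w i) * fderiv ℝ f (fun j => t ^ (w j) * y j) (Pi.single i 1) =
      t ^ k * fderiv ℝ f y (Pi.single i 1) := by
  let L : (Fin n → ℝ) →L[ℝ] (Fin n → ℝ) :=
    ContinuousLinearMap.pi fun j => t ^ (w j) • ContinuousLinearMap.proj j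
  have hleft : HasFDerivAt (fun z => f (L z)) ((fderiv ℝ f (L y)).comp L) y :=
    (hf (L y)).hasFDerivAt.comp y L.hasFDerivAt
  have hright : HasFDerivAt (fun z => f (L z)) (t ^ k • fderiv ℝ f y) y := by
    have hL : (fun z => f (L z)) = fun z => t ^ k * f z := funext fun z => hom t z
    rw [hL]
    exact (hf y).hasFDerivAt.const_mul (t ^ k)
  have hsingle : L (Pi.single i 1) = t ^ (w i) • Pi.single i (1 : ℝ) := by
    ext j
    by_cases hj : j = i
    · subst hj; simp [L]
    · simp [L, hj]
  have happly := DFunLike.congr_fun (hleft.unique hright) (Pi.single i 1)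
  rw [ContinuousLinearMap.comp_apply, hsingle, map_smul] at happly
  exact happly

theorem weighted_euler_identity {n : ℕ} {w : Fin n → ℕ} {k : ℕ}
    {f : (Fin n → ℝ) → ℝ} (hf : Differentiable ℝ f)
    (hom : ∀ (t : ℝ) (y : Fin n → ℝ), f (fun i => t ^ (w i) * y i) = t ^ k * f y)
    (y : Fin n → ℝ) :
    ∑ i, w i * y i * fderiv ℝ f y (Pi.single i 1) = k * f y := by
  have hcurve : HasDerivAt (fun (t : ℝ) i => t ^ (w i) * y i) (fun i => w i * y i) 1 := by
    rw [hasDerivAt_pi]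
    intro i
    simpa using (hasDerivAt_pow (w i) (1 : ℝ)).mul_const (y i)
  have hpoint : (fun i => (1 : ℝ) ^ (w i) * y i) = y := by simp
  have hleft : HasDerivAt (fun t : ℝ => f (fun i => t ^ (w i) * y i))
      (fderiv ℝ f y (fun i => w i * y i)) 1 := by
    have hfd : HasFDerivAt f (fderiv ℝ f y) (fun i => (1 : ℝ) ^ (w i) * y i) := by
      rw [hpoint]
      exact (hf y).hasFDerivAt
    exact hfd.comp_hasDerivAt (1 : ℝ) hcurve
  have hright : HasDerivAt (fun t : ℝ => f (fun i => t ^ (w i) * y i)) (k * f y) 1 := by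
    simp only [hom]
    simpa using (hasDerivAt_pow k (1 : ℝ)).mul_const (f y)
  rw [← hleft.unique hright, pi_eq_sum_univ' (fun i => (w i : ℝ) * y i), map_sum]
  refine Finset.sum_congr rfl fun i _ => ?_
  rw [map_smul, smul_eq_mul]

theorem eq_of_eq_of_ne_zero {g h : ℝ → ℝ} (hg : Continuous g) (hh : Continuous h)
    (heq : ∀ t ≠ 0, g t = h t) (t : ℝ) : g t = h t :=
  congrFun (hg.ext_on (dense_compl_singleton (0 : ℝ)) hh fun s hs => heq s hs) t

/-- Homogeneous functions of degree `k` on a graded bundle over a point are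
weighted-homogeneous polynomials. -/
theorem homogeneous_smooth_is_weighted_homogeneous_polynomial (n : ℕ)
    (w : Fin n → ℕ) (hw : ∀ i, 1 ≤ w i) (k : ℕ)
    (f : (Fin n → ℝ) → ℝ) (hf : ContDiff ℝ (⊤ : ℕ∞) f)
    (hom : ∀ (t : ℝ) (y : Fin n → ℝ),
      f (fun i => t ^ (w i) * y i) = t ^ k * f y) :
    ∃ P : MvPolynomial (Fin n) ℝ,
      MvPolynomial.IsWeightedHomogeneous w P k ∧
      ∀ y : Fin n → ℝ, f y = MvPolynomial.eval y P := by
  induction k using Nat.strong_induction_on generalizing f with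
  | _ k ih =>
  rcases Nat.eq_zero_or_pos k with rfl | hk
  · refine ⟨MvPolynomial.C (f 0), MvPolynomial.isWeightedHomogeneous_C w _, fun y => ?_⟩
    have hzero : (fun i => (0 : ℝ) ^ (w i) * y i) = 0 := by
      ext i
      simp [zero_pow (Nat.one_le_iff_ne_zero.mp (hw i))]
    simpa [hzero] using (hom 0 y).symm
  have hdiff : Differentiable ℝ f := hf.differentiable (by simp)
  have hpartial : ∀ i, ContDiff ℝ (⊤ : ℕ∞) fun y => fderiv ℝ f y (Pi.single i 1) := fun i =>
    (hf.fderiv_right (m := (⊤ : ℕ∞)) le_rfl).clm_apply contDiff_const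
  have hray : ∀ i (y : Fin n → ℝ),
      Continuous fun t : ℝ => fderiv ℝ f (fun j => t ^ (w j) * y j) (Pi.single i 1) :=
    fun i y => (hpartial i).continuous.comp
      (f := fun (t : ℝ) j => t ^ (w j) * y j) (by fun_prop)
  have hpoly : ∀ i, ∃ P : MvPolynomial (Fin n) ℝ,
      MvPolynomial.IsWeightedHomogeneous w (MvPolynomial.X i * P) k ∧
      ∀ y, fderiv ℝ f y (Pi.single i 1) = MvPolynomial.eval y P := by
    intro i
    rcases le_or_gt (w i) k with hik | hik
    · obtain ⟨P, hP, hfP⟩ := ih (k - w i) (by have := hw i; omega) _ (hpartial i) fun t y => by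
        refine eq_of_eq_of_ne_zero (hray i y)
          ((continuous_pow (k - w i)).mul_const (fderiv ℝ f y (Pi.single i 1))) (fun s hs => ?_) t
        apply mul_left_cancel₀ (pow_ne_zero (w i) hs)
        rw [fderiv_single_weighted_scaling hdiff hom, ← mul_assoc, ← pow_add,
          Nat.add_sub_cancel' hik]
      refine ⟨P, ?_, hfP⟩
      simpa only [Nat.add_sub_cancel' hik] using
        (MvPolynomial.isWeightedHomogeneous_X ℝ w i).mul hP
    · refine ⟨0, by simpa using MvPolynomial.isWeightedHomogeneous_zero ℝ w k, fun y => ?_⟩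
      have hzero := eq_of_eq_of_ne_zero (continuous_const (y := fderiv ℝ f y (Pi.single i 1)))
        (h := fun s => s ^ (w i - k) * fderiv ℝ f (fun j => s ^ (w j) * y j) (Pi.single i 1))
        ((continuous_pow (w i - k)).mul (hray i y)) (fun s hs => by
          apply mul_left_cancel₀ (pow_ne_zero k hs)
          rw [← fderiv_single_weighted_scaling hdiff hom, ← mul_assoc, ← pow_add,
            Nat.add_sub_cancel' hik.le]) 0
      simpa [zero_pow (Nat.sub_ne_zero_of_lt hik)] using hzero
  choose P hP hfP using hpoly
  refine ⟨∑ i, MvPolynomial.C ((w i : ℝ) / k) * (MvPolynomial.X i * P i),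
    MvPolynomial.IsWeightedHomogeneous.sum _ _ _ fun i _ => (hP i).C_mul _, fun y => ?_⟩
  have hk' : (k : ℝ) ≠ 0 := Nat.cast_ne_zero.mpr hk.ne'
  apply mul_left_cancel₀ hk'
  rw [← weighted_euler_identity hdiff hom y, map_sum, Finset.mul_sum]
  refine Finset.sum_congr rfl fun i _ => ?_
  simp only [map_mul, MvPolynomial.eval_C, MvPolynomial.eval_X, hfP]
  field_simp
end

section
/- Let a ∈ ℝ and let f : ℝ → ℝ be C^∞ on the open interval (-1, 1) and satisfy x · f′(x) = a · f(x) for all x ∈ (-1, 1). Then either f vanishes identically on (-1, 1), or a is a non-negative integer n and there exists a constant c ∈ ℝ with f(x) = c · xⁿ for all x ∈ (-1, 1). (On the graded manifold F′ = (-1,1) with the restricted Euler vector field x∂ₓ, all homogeneous functions have non-negative integer degrees and are polynomials in the homogeneous coordinate x.) -/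
/-- A differentiable function on `(-1, 1)` homogeneous of negative degree vanishes. -/
theorem eq_zero_of_homogeneous_of_neg {a : ℝ} (ha : a < 0) {f : ℝ → ℝ}
    (hf : DifferentiableOn ℝ f (Set.Ioo (-1) 1))
    (heq : ∀ x ∈ Set.Ioo (-1 : ℝ) 1, x * deriv f x = a * f x) :
    ∀ x ∈ Set.Ioo (-1 : ℝ) 1, f x = 0 := by
  intro x hx
  have hmem : ∀ t ∈ Set.Icc (0 : ℝ) 1, t * x ∈ Set.Ioo (-1 : ℝ) 1 := by
    rintro t ⟨h0, h1⟩
    rw [Set.mem_Ioo, ← abs_lt] at hx ⊢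
    rw [abs_mul, abs_of_nonneg h0]
    exact (mul_le_of_le_one_left (abs_nonneg x) h1).trans_lt hx
  have hderiv : ∀ t ∈ Set.Icc (0 : ℝ) 1,
      HasDerivAt (fun t => f (t * x) ^ 2) (2 * f (t * x) * (deriv f (t * x) * x)) t := by
    intro t ht
    have hd := (hf.differentiableAt (isOpen_Ioo.mem_nhds (hmem t ht))).hasDerivAt
    have h := (hd.comp t (hasDerivAt_mul_const x)).pow 2
    exact h.congr_deriv (by simp)
  have hanti : AntitoneOn (fun t => f (t * x) ^ 2) (Set.Icc 0 1) := by
    refine antitoneOn_of_deriv_nonpos (convex_Icc 0 1)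
      (fun t ht => (hderiv t ht).continuousAt.continuousWithinAt)
      (fun t ht => (hderiv t (interior_subset ht)).differentiableAt.differentiableWithinAt) ?_
    intro t ht
    rw [(hderiv t (interior_subset ht)).deriv]
    rw [interior_Icc] at ht
    have h := heq _ (hmem t ⟨ht.1.le, ht.2.le⟩)
    refine nonpos_of_mul_nonpos_right ?_ ht.1
    calc t * (2 * f (t * x) * (deriv f (t * x) * x))
        = 2 * f (t * x) * (t * x * deriv f (t * x)) := by ring
      _ = 2 * a * f (t * x) ^ 2 := by rw [h]; ring
      _ ≤ 0 := mul_nonpos_of_nonpos_of_nonneg (by linarith) (sq_nonneg _)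
  have h0 : f 0 = 0 := by
    have h := heq 0 (by norm_num)
    rw [zero_mul, eq_comm, mul_eq_zero] at h
    exact h.resolve_left ha.ne
  have h := hanti (Set.left_mem_Icc.2 zero_le_one) (Set.right_mem_Icc.2 zero_le_one) zero_le_one
  simp only [one_mul, zero_mul, h0] at h
  exact pow_eq_zero_iff two_ne_zero |>.1 (le_antisymm (by simpa using h) (sq_nonneg _))

/-- The derivative of a homogeneous function of degree `a` is homogeneous of degree `a - 1`. -/
theorem deriv_homogeneous {a : ℝ} {f : ℝ → ℝ} {s : Set ℝ} (hs : IsOpen s)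
    (hf : DifferentiableOn ℝ f s) (hf' : DifferentiableOn ℝ (deriv f) s)
    (heq : ∀ x ∈ s, x * deriv f x = a * f x) :
    ∀ x ∈ s, x * deriv (deriv f) x = (a - 1) * deriv f x := by
  intro x hx
  have hxs := hs.mem_nhds hx
  have hl := (hasDerivAt_id x).mul (hf'.differentiableAt hxs).hasDerivAt
  have hr := (hf.differentiableAt hxs).hasDerivAt.const_mul a
  have hlr : (fun y => a * f y) =ᶠ[nhds x] id * deriv f := by
    filter_upwards [hxs] with y hy using (heq y hy).symm
  have h := (hl.congr_of_eventuallyEq hlr).unique hr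
  simp only [id, one_mul] at h
  linarith

/-- On the graded manifold `F' = (-1, 1)` with the Euler vector field `x ∂ₓ`,
any homogeneous smooth function of degree `a` either vanishes identically or has
non-negative integer degree `n` and equals `c · xⁿ`. -/
theorem homogeneous_on_Ioo_neg_one_one (a : ℝ) (f : ℝ → ℝ)
    (hf : ContDiffOn ℝ (⊤ : ℕ∞) f (Set.Ioo (-1) 1))
    (heq : ∀ x ∈ Set.Ioo (-1 : ℝ) 1, x * deriv f x = a * f x) :
    (∀ x ∈ Set.Ioo (-1 : ℝ) 1, f x = 0) ∨
    ∃ (n : ℕ) (c : ℝ), a = (n : ℝ) ∧ ∀ x ∈ Set.Ioo (-1 : ℝ) 1, f x = c * x ^ n := by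
  obtain ⟨N, hN⟩ := exists_nat_gt a
  induction N generalizing a f with
  | zero =>
    exact Or.inl (eq_zero_of_homogeneous_of_neg (by exact_mod_cast hN)
      (hf.differentiableOn (by simp)) heq)
  | succ N ih =>
    have hd : DifferentiableOn ℝ f (Set.Ioo (-1) 1) := hf.differentiableOn (by simp)
    have hf' : ContDiffOn ℝ (⊤ : ℕ∞) (deriv f) (Set.Ioo (-1) 1) :=
      hf.deriv_of_isOpen isOpen_Ioo (by simp)
    have hd' := hf'.differentiableOn (by simp)
    have heq' := deriv_homogeneous isOpen_Ioo hd hd' heq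
    rcases eq_or_ne a 0 with rfl | ha
    · have hzero := eq_zero_of_homogeneous_of_neg (by norm_num) hd' heq'
      refine Or.inr ⟨0, f 0, by simp, fun x hx => ?_⟩
      rw [pow_zero, mul_one]
      exact isOpen_Ioo.is_const_of_deriv_eq_zero isPreconnected_Ioo hd hzero hx (by norm_num)
    · push_cast at hN
      rcases ih (a - 1) (deriv f) hf' heq' (by linarith) with h | ⟨n, c, hn, h⟩
      · refine Or.inl fun x hx => ?_
        have hx' := heq x hx
        rw [h x hx, mul_zero, eq_comm, mul_eq_zero] at hx'
        exact hx'.resolve_left ha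
      · refine Or.inr ⟨n + 1, c / a, by push_cast; linarith, fun x hx => ?_⟩
        have hx' := heq x hx
        rw [h x hx] at hx'
        field_simp
        rw [mul_comm, ← hx']
        ring
end

section
/- Let R be a commutative ring, A a commutative R-algebra, and L a Lie algebra over R. Equip pairs (Y, Z), with Y ∈ A ⊗[R] L and Z ∈ Derivation R A A, with the bracket ⁅(Y₁, Z₁), (Y₂, Z₂)⁆ := (⁅Y₁, Y₂⁆ + (Z₁ ⊗ id_L)(Y₂) − (Z₂ ⊗ id_L)(Y₁), ⁅Z₁, Z₂⁆), and with the componentwise A-module structure a • (Y, Z) := (a • Y, a • Z). Then for all pairs p = (Y₁, Z₁) and q = (Y₂, Z₂) and all a ∈ A, one has the Leibniz (anchor) identity ⁅p, a • q⁆ = a • ⁅p, q⁆ + (Z₁ a) • q. (This expresses that the anchor map of the reduced weighted Lie algebroid is ρ(Y, Z) = Z.) -/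
open scoped TensorProduct

/-- The reduced bracket
`[(Y₁,Z₁),(Y₂,Z₂)] = ([Y₁,Y₂] + Z₁(Y₂) − Z₂(Y₁), Z₁∘Z₂ − Z₂∘Z₁)`
on pairs of a `𝔤`-valued function (an element of `A ⊗[R] L`) and a vector field
(a derivation of `A`). -/
noncomputable def reducedBracket {R A L : Type*} [CommRing R] [CommRing A] [Algebra R A]
    [LieRing L] [LieAlgebra R L]
    (p q : (A ⊗[R] L) × Derivation R A A) : (A ⊗[R] L) × Derivation R A A :=
  (⁅p.1, q.1⁆ + LinearMap.rTensor L p.2.toLinearMap q.1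
      - LinearMap.rTensor L q.2.toLinearMap p.1, ⁅p.2, q.2⁆)

namespace Derivation

variable {R A M : Type*} [CommRing R] [CommRing A] [Algebra R A] [AddCommGroup M] [Module R M]

theorem rTensor_apply_smul (Z : Derivation R A A) (a : A) (y : A ⊗[R] M) :
    LinearMap.rTensor M Z.toLinearMap (a • y) =
      a • LinearMap.rTensor M Z.toLinearMap y + Z a • y := by
  induction y with
  | zero => simp
  | add x y hx hy => simp only [smul_add, map_add, hx, hy]; abel
  | tmul b x => simp [TensorProduct.smul_tmul', TensorProduct.add_tmul, mul_comm]

theorem rTensor_smul_apply (Z : Derivation R A A) (a : A) (y : A ⊗[R] M) :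
    LinearMap.rTensor M (a • Z).toLinearMap y = a • LinearMap.rTensor M Z.toLinearMap y := by
  induction y with
  | zero => simp
  | add x y hx hy => simp only [smul_add, map_add, hx, hy]
  | tmul b x => simp [TensorProduct.smul_tmul']

theorem lie_smul_eq_smul_lie_add (Z₁ Z₂ : Derivation R A A) (a : A) :
    ⁅Z₁, a • Z₂⁆ = a • ⁅Z₁, Z₂⁆ + Z₁ a • Z₂ := by
  ext b
  simp only [commutator_apply, smul_apply, add_apply, smul_eq_mul, leibniz]
  ring

end Derivation

/-- The Leibniz (anchor) identity for the reduced bracket: the anchor of the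
reduced weighted Lie algebroid is `ρ(Y, Z) = Z`. -/
theorem reducedBracket_leibniz_anchor {R A L : Type*} [CommRing R]
    [CommRing A] [Algebra R A] [LieRing L] [LieAlgebra R L]
    (p q : (A ⊗[R] L) × Derivation R A A) (a : A) :
    reducedBracket p (a • q) = a • reducedBracket p q + (p.2 a) • q := by
  refine Prod.ext ?_ (Derivation.lie_smul_eq_smul_lie_add p.2 q.2 a)
  simp only [reducedBracket, Prod.fst_add, Prod.smul_fst, Prod.smul_snd, lie_smul,
    Derivation.rTensor_apply_smul, Derivation.rTensor_smul_apply, smul_add, smul_sub]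
  abel
end
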